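/- Let X be a locally compact Hausdorff space, H a separable complex Hilbert space, p ∈ [1,∞), and T ∈ C₀(X, S_p(H)). Then for every ε > 0 there exist finitely many v_1,…,v_n, w_1,…,w_n ∈ C₀(X,H) such that sup_{x∈X} ‖T(x) − ∑_{i=1}^n |v_i(x)⟩⟨w_i(x)|‖ < ε, where the norm is the operator norm on B(H); that is, T is a compact operator on the Hilbert C₀(X)-module C₀(X,H). -/

import Mathlib

open ContinuousLinearMap Filter Topology

noncomputable section

variable {H : Type*} [NormedAddCommGroup H] [InnerProductSpace ℂ H] [CompleteSpace H]
  [TopologicalSpace.SeparableSpace H]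

local notation "⟪" x ", " y "⟫" => @inner ℂ _ _ x y

/-- `|T|^p = (T*T)^{p/2}`, via the continuous functional calculus. -/
def absPow (T : H →L[ℂ] H) (p : ℝ) : H →L[ℂ] H :=
  cfc (fun t : ℝ => t ^ (p / 2)) (ContinuousLinearMap.adjoint T ∘L T)

/-- The trace `∑ᵢ ⟨fᵢ, A fᵢ⟩ ∈ [0,∞]` of a positive operator `A`, computed in the
orthonormal basis `f` (for positive `A` the value is independent of the basis). -/
def posTr (f : HilbertBasis ℕ ℂ H) (A : H →L[ℂ] H) : ENNReal :=
  ∑' i, ENNReal.ofReal (RCLike.re ⟪f i, A (f i)⟫)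

/-- `tr |T|^p ∈ [0,∞]`. `T` lies in the Schatten class `S_p(H)` iff this is finite. -/
def trAbsPow (f : HilbertBasis ℕ ℂ H) (T : H →L[ℂ] H) (p : ℝ) : ENNReal :=
  posTr f (absPow T p)

/-- The Schatten `p`-norm `‖T‖_p = (tr |T|^p)^{1/p}`. -/
def sNorm (f : HilbertBasis ℕ ℂ H) (p : ℝ) (T : H →L[ℂ] H) : ℝ :=
  (trAbsPow f T p).toReal ^ (1 / p)

/-- `T : X → B(H)` belongs to `C₀(X, S_p(H))`: pointwise Schatten class, continuous
with respect to the Schatten `p`-norm, and vanishing at infinity with respect to it. -/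
def IsC0Schatten (f : HilbertBasis ℕ ℂ H) (p : ℝ) {X : Type*} [TopologicalSpace X]
    (T : X → H →L[ℂ] H) : Prop :=
  (∀ x, trAbsPow f (T x) p ≠ ⊤) ∧
  (∀ x, Tendsto (fun y => sNorm f p (T y - T x)) (nhds x) (nhds 0)) ∧
  Tendsto (fun x => sNorm f p (T x)) (cocompact X) (nhds 0)

section HilbertTrace

open scoped ENNReal NNReal

variable {E : Type*} [NormedAddCommGroup E] [InnerProductSpace ℂ E]
  {ι κ : Type*}

theorem tsum_enorm_inner_sq (e : HilbertBasis ι ℂ E) (x : E) :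
    ∑' i, ‖⟪e i, x⟫‖ₑ ^ 2 = ‖x‖ₑ ^ 2 := by
  have h := (Complex.hasSum_re (e.hasSum_inner_mul_inner x x))
  have h' : HasSum (fun i => ‖⟪e i, x⟫‖ ^ 2) (‖x‖ ^ 2) := by
    convert h using 1
    · ext i
      rw [← inner_conj_symm x (e i), ← Complex.normSq_eq_conj_mul_self, Complex.ofReal_re,
        Complex.normSq_eq_norm_sq]
    · exact (inner_self_eq_norm_sq (𝕜 := ℂ) x).symm
  have h₂ := ENNReal.ofReal_tsum_of_nonneg (fun i => sq_nonneg ‖⟪e i, x⟫‖) h'.summable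
  rw [h'.tsum_eq] at h₂
  simpa [ENNReal.ofReal_pow, ofReal_norm] using h₂.symm

/-- The trace of an operator in a Hilbert basis with an arbitrary index type. -/
def hilbertTrace (e : HilbertBasis ι ℂ E) (A : E →L[ℂ] E) : ℝ≥0∞ :=
  ∑' i, ENNReal.ofReal (RCLike.re ⟪e i, A (e i)⟫)

theorem re_inner_nonneg_of_nonneg {A : E →L[ℂ] E} (hA : 0 ≤ A) (x : E) :
    0 ≤ RCLike.re ⟪x, A x⟫ :=
  ((nonneg_iff_isPositive A).1 hA).re_inner_nonneg_right x

theorem re_inner_mono {A B : E →L[ℂ] E} (h : A ≤ B) (x : E) :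
    RCLike.re ⟪x, A x⟫ ≤ RCLike.re ⟪x, B x⟫ := by
  have := ((le_def A B).1 h).re_inner_nonneg_right x
  simpa [inner_sub_right] using this

theorem hilbertTrace_mono (e : HilbertBasis ι ℂ E) {A B : E →L[ℂ] E} (h : A ≤ B) :
    hilbertTrace e A ≤ hilbertTrace e B :=
  ENNReal.tsum_le_tsum fun i => ENNReal.ofReal_le_ofReal (re_inner_mono h (e i))

theorem hilbertTrace_add_le (e : HilbertBasis ι ℂ E) (A B : E →L[ℂ] E) :
    hilbertTrace e (A + B) ≤ hilbertTrace e A + hilbertTrace e B := by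
  rw [hilbertTrace, hilbertTrace, hilbertTrace, ← ENNReal.tsum_add]
  refine ENNReal.tsum_le_tsum fun i => ?_
  rw [add_apply, inner_add_right, map_add]
  exact ENNReal.ofReal_add_le

theorem hilbertTrace_smul (e : HilbertBasis ι ℂ E) {M : ℝ} (hM : 0 ≤ M) (A : E →L[ℂ] E) :
    hilbertTrace e (M • A) = ENNReal.ofReal M * hilbertTrace e A := by
  rw [hilbertTrace, hilbertTrace, ← ENNReal.tsum_mul_left]
  refine tsum_congr fun i => ?_
  rw [smul_apply, inner_smul_right_eq_smul, ← ENNReal.ofReal_mul hM, RCLike.smul_re]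

variable [CompleteSpace E]

theorem hilbertTrace_star_mul_self (e : HilbertBasis ι ℂ E) (S : E →L[ℂ] E) :
    hilbertTrace e (star S * S) = ∑' i, ‖S (e i)‖ₑ ^ 2 := by
  refine tsum_congr fun i => ?_
  rw [star_eq_adjoint, mul_apply_eq_comp, adjoint_inner_right, inner_self_eq_norm_sq,
    ENNReal.ofReal_pow (norm_nonneg _), ofReal_norm]

theorem hilbertTrace_star_mul_self_comm (e : HilbertBasis ι ℂ E) (g : HilbertBasis κ ℂ E)
    (S : E →L[ℂ] E) : hilbertTrace e (star S * S) = hilbertTrace g (S * star S) := by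
  have h := hilbertTrace_star_mul_self g (star S)
  rw [star_star] at h
  rw [hilbertTrace_star_mul_self, h]
  simp_rw [← tsum_enorm_inner_sq g (S _), ← tsum_enorm_inner_sq e (star S _)]
  rw [ENNReal.tsum_comm]
  refine tsum_congr fun j => tsum_congr fun i => ?_
  rw [star_eq_adjoint, adjoint_inner_right, ← inner_conj_symm, RCLike.enorm_conj]

theorem hilbertTrace_basis_indep (e : HilbertBasis ι ℂ E) (g : HilbertBasis κ ℂ E)
    {A : E →L[ℂ] E} (hA : 0 ≤ A) : hilbertTrace e A = hilbertTrace g A := by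
  have hs : star (CFC.sqrt A) = CFC.sqrt A := (CFC.sqrt_nonneg A).isSelfAdjoint.star_eq
  have h := hilbertTrace_star_mul_self_comm e g (CFC.sqrt A)
  rwa [hs, CFC.sqrt_mul_sqrt_self A hA] at h

theorem enorm_sq_le_tsum (e : HilbertBasis ι ℂ E) (S : E →L[ℂ] E) :
    ‖S‖ₑ ^ 2 ≤ ∑' i, ‖S (e i)‖ₑ ^ 2 := by
  by_cases htop : ∑' i, ‖S (e i)‖ₑ ^ 2 = ⊤
  · simp [htop]
  have hbound (x : E) : ‖star S x‖ₑ ^ 2 ≤ (∑' i, ‖S (e i)‖ₑ ^ 2) * ‖x‖ₑ ^ 2 := by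
    rw [← tsum_enorm_inner_sq e (star S x), ← ENNReal.tsum_mul_right]
    refine ENNReal.tsum_le_tsum fun i => ?_
    rw [star_eq_adjoint, adjoint_inner_right, ← mul_pow]
    gcongr
    simp only [enorm_eq_nnnorm, ← ENNReal.coe_mul, ENNReal.coe_le_coe]
    exact nnnorm_inner_le_nnnorm (𝕜 := ℂ) (S (e i)) x
  set M := (∑' i, ‖S (e i)‖ₑ ^ 2).toReal
  have hM : ∑' i, ‖S (e i)‖ₑ ^ 2 = ENNReal.ofReal M := (ENNReal.ofReal_toReal htop).symm
  have h : ‖star S‖ ≤ √M := by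
    refine opNorm_le_bound _ (Real.sqrt_nonneg _) fun x => ?_
    refine Real.le_sqrt_of_sq_le ?_ |>.trans ?_ (b := √(M * ‖x‖ ^ 2))
    · have h := hbound x
      rw [hM, ← ofReal_norm, ← ofReal_norm, ← ENNReal.ofReal_pow (norm_nonneg _),
        ← ENNReal.ofReal_pow (norm_nonneg _), ← ENNReal.ofReal_mul ENNReal.toReal_nonneg] at h
      exact (ENNReal.ofReal_le_ofReal_iff (by positivity)).1 h
    · rw [Real.sqrt_mul ENNReal.toReal_nonneg, Real.sqrt_sq (norm_nonneg _)]
  rw [norm_star] at h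
  rw [hM, ← ofReal_norm, ← ENNReal.ofReal_pow (norm_nonneg _)]
  exact ENNReal.ofReal_le_ofReal ((Real.le_sqrt (norm_nonneg _) ENNReal.toReal_nonneg).1 h)

theorem enorm_le_hilbertTrace (e : HilbertBasis ι ℂ E) {A : E →L[ℂ] E} (hA : 0 ≤ A) :
    ‖A‖ₑ ≤ hilbertTrace e A := by
  have hs : star (CFC.sqrt A) = CFC.sqrt A := (CFC.sqrt_nonneg A).isSelfAdjoint.star_eq
  have hA' : A = star (CFC.sqrt A) * CFC.sqrt A := by rw [hs, CFC.sqrt_mul_sqrt_self A hA]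
  rw [hA', hilbertTrace_star_mul_self]
  refine le_trans (le_of_eq ?_) (enorm_sq_le_tsum e _)
  rw [← ofReal_norm, CStarRing.norm_star_mul_self, ENNReal.ofReal_mul (norm_nonneg _), ofReal_norm,
    sq]

end HilbertTrace

section BasisProjection

open scoped ENNReal NNReal

variable {E : Type*} [NormedAddCommGroup E] [InnerProductSpace ℂ E]

/-- The orthogonal projection onto the span of the first `n` vectors of a Hilbert basis. -/
def basisProj (e : HilbertBasis ℕ ℂ E) (n : ℕ) : E →L[ℂ] E :=
  ∑ i ∈ Finset.range n, (innerSL ℂ (e i)).smulRight (e i)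

theorem basisProj_apply (e : HilbertBasis ℕ ℂ E) (n : ℕ) (x : E) :
    basisProj e n x = ∑ i ∈ Finset.range n, ⟪e i, x⟫ • e i := by
  simp [basisProj, sum_apply]

theorem basisProj_apply_basis (e : HilbertBasis ℕ ℂ E) (n j : ℕ) :
    basisProj e n (e j) = if j < n then e j else 0 := by
  simp [basisProj_apply, orthonormal_iff_ite.1 e.orthonormal]

theorem basisProj_mul_of_le (e : HilbertBasis ℕ ℂ E) {m n : ℕ} (hmn : m ≤ n) :
    basisProj e n * basisProj e m = basisProj e m := by
  ext x
  rw [mul_apply_eq_comp, basisProj_apply e m x, map_sum]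
  refine Finset.sum_congr rfl fun i hi => ?_
  rw [map_smul, basisProj_apply_basis, if_pos ((Finset.mem_range.1 hi).trans_le hmn)]

/-- `S` is the norm limit of its restrictions to the spans of initial segments of `e`. -/
def IsBasisLimit (e : HilbertBasis ℕ ℂ E) (S : E →L[ℂ] E) : Prop :=
  Tendsto (fun n => ‖S * (1 - basisProj e n)‖) atTop (𝓝 0)

theorem IsBasisLimit.sub {e : HilbertBasis ℕ ℂ E} {S R : E →L[ℂ] E} (hS : IsBasisLimit e S)
    (hR : IsBasisLimit e R) : IsBasisLimit e (S - R) := by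
  refine squeeze_zero (fun _ => norm_nonneg _) (fun n => ?_) (by simpa using hS.add hR)
  rw [sub_mul]
  exact norm_sub_le _ _

variable [CompleteSpace E]

theorem isStarProjection_basisProj (e : HilbertBasis ℕ ℂ E) (n : ℕ) :
    IsStarProjection (basisProj e n) := by
  refine ⟨basisProj_mul_of_le e le_rfl, ?_⟩
  rw [isSelfAdjoint_iff_isSymmetric]
  intro x y
  simp [basisProj_apply, sum_inner, inner_sum, inner_smul_left, inner_smul_right, mul_comm]

theorem norm_one_sub_basisProj_le (e : HilbertBasis ℕ ℂ E) (n : ℕ) :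
    ‖1 - basisProj e n‖ ≤ 1 :=
  (isStarProjection_basisProj e n).one_sub.norm_le

theorem IsBasisLimit.mul_left {e : HilbertBasis ℕ ℂ E} {S : E →L[ℂ] E} (hS : IsBasisLimit e S)
    (R : E →L[ℂ] E) : IsBasisLimit e (R * S) := by
  refine squeeze_zero (fun _ => norm_nonneg _) (fun n => ?_) (by simpa using hS.const_mul ‖R‖)
  rw [mul_assoc]
  exact norm_mul_le _ _

theorem IsBasisLimit.of_star_mul_self {e : HilbertBasis ℕ ℂ E} {S : E →L[ℂ] E}
    (h : IsBasisLimit e (star S * S)) : IsBasisLimit e S := by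
  have hsq : Tendsto (fun n => ‖S * (1 - basisProj e n)‖ ^ 2) atTop (𝓝 0) := by
    refine squeeze_zero (fun _ => sq_nonneg _) (fun n => ?_) h
    rw [sq, ← CStarRing.norm_star_mul_self, star_mul, mul_assoc, ← mul_assoc (star S)]
    refine (norm_mul_le _ _).trans (mul_le_of_le_one_left (norm_nonneg _) ?_)
    rw [norm_star]
    exact norm_one_sub_basisProj_le e n
  have := hsq.sqrt
  simpa [IsBasisLimit, Real.sqrt_sq] using this

theorem IsBasisLimit.isCompactOperator {e : HilbertBasis ℕ ℂ E} {S : E →L[ℂ] E}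
    (h : IsBasisLimit e S) : IsCompactOperator S := by
  refine isCompactOperator_of_tendsto (F := fun n => S * basisProj e n) (l := atTop) ?_
    (Eventually.of_forall fun n => ?_)
  · rw [tendsto_iff_norm_sub_tendsto_zero]
    refine h.congr fun n => ?_
    rw [mul_sub, mul_one, norm_sub_rev]
  · refine IsCompactOperator.clm_comp ?_ S
    have : ∀ n, basisProj e n ∈ compactOperator (RingHom.id ℂ) E E := by
      intro n
      refine Submodule.sum_mem _ fun i _ => ?_
      have h1 : IsCompactOperator (id : ℂ → ℂ) :=
        isCompactOperator_id_iff_finiteDimensional (𝕜 := ℂ).2 inferInstance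
      exact (h1.comp_clm (innerSL ℂ (e i))).clm_comp ((1 : ℂ →L[ℂ] ℂ).smulRight (e i))
    exact this n

theorem isBasisLimit_of_tsum_ne_top {e : HilbertBasis ℕ ℂ E} {S : E →L[ℂ] E}
    (h : ∑' i, ‖S (e i)‖ₑ ^ 2 ≠ ⊤) : IsBasisLimit e S := by
  have hle (n : ℕ) : ‖S * (1 - basisProj e n)‖ₑ ^ 2 ≤ ∑' i, ‖S (e (i + n))‖ₑ ^ 2 := by
    refine (enorm_sq_le_tsum e _).trans ?_
    have hi (i : ℕ) : (S * (1 - basisProj e n)) (e i) = if i < n then 0 else S (e i) := by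
      rw [mul_apply_eq_comp, sub_apply, one_apply_eq_self, basisProj_apply_basis]
      split_ifs <;> simp
    simp_rw [hi]
    rw [← ENNReal.summable.sum_add_tsum_nat_add' (k := n), Finset.sum_eq_zero, zero_add]
    · simp
    · intro i hi
      simp [Finset.mem_range.1 hi]
  have h0 : Tendsto (fun n => ‖S * (1 - basisProj e n)‖ₑ ^ 2) atTop (𝓝 0) :=
    tendsto_of_tendsto_of_tendsto_of_le_of_le tendsto_const_nhds
      (ENNReal.tendsto_sum_nat_add _ h) (fun _ => zero_le) hle
  have h1 := (ENNReal.tendsto_toReal ENNReal.zero_ne_top).comp h0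
  have := h1.sqrt
  simpa [IsBasisLimit, Function.comp_def, Real.sqrt_sq] using this

end BasisProjection

section OperatorPowers

universe u v

open scoped ENNReal NNReal

theorem Real.add_mul_sub_le_rpow {m t r : ℝ} (hm : 0 < m) (ht : 0 ≤ t) (hr : 1 ≤ r) :
    m ^ r + r * (m ^ r / m) * (t - m) ≤ t ^ r := by
  have h := one_add_mul_self_le_rpow_one_add (s := t / m - 1)
    (by linarith [div_nonneg ht hm.le]) hr
  rw [add_sub_cancel, Real.div_rpow ht hm.le, le_div_iff₀ (Real.rpow_pos_of_pos hm r)] at h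
  refine le_trans (le_of_eq ?_) h
  field_simp

theorem Real.rpow_le_add_mul_sub {m t r : ℝ} (hm : 0 < m) (ht : 0 ≤ t) (hr : 0 ≤ r)
    (hr' : r ≤ 1) : t ^ r ≤ m ^ r + r * (m ^ r / m) * (t - m) := by
  have h := rpow_one_add_le_one_add_mul_self (s := t / m - 1)
    (by linarith [div_nonneg ht hm.le]) hr hr'
  rw [add_sub_cancel, Real.div_rpow ht hm.le, div_le_iff₀ (Real.rpow_pos_of_pos hm r)] at h
  refine h.trans (le_of_eq ?_)
  field_simp

variable {E : Type*} [NormedAddCommGroup E] [InnerProductSpace ℂ E] {ι κ : Type*}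

theorem re_inner_algebraMap_add_smul (a : E →L[ℂ] E) (c k : ℝ) {x : E} (hx : ‖x‖ = 1) :
    RCLike.re ⟪x, (algebraMap ℝ (E →L[ℂ] E) c + k • a) x⟫ = c + k * RCLike.re ⟪x, a x⟫ := by
  rw [Algebra.algebraMap_eq_smul_one, add_apply, smul_apply, smul_apply, one_apply_eq_self,
    inner_add_right, inner_smul_right_eq_smul, inner_smul_right_eq_smul, map_add, RCLike.smul_re,
    RCLike.smul_re, inner_self_eq_norm_sq, hx]
  ring

variable [CompleteSpace E]

theorem cfc_affine {a : E →L[ℂ] E} (ha : 0 ≤ a) (c k : ℝ) :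
    cfc (fun t : ℝ => c + k * t) a = algebraMap ℝ (E →L[ℂ] E) c + k • a := by
  have hsa : IsSelfAdjoint a := ha.isSelfAdjoint
  rw [cfc_const_add c (fun t => k * t) a, cfc_const_mul_id k a]

theorem rpow_re_inner_le {a : E →L[ℂ] E} (ha : 0 ≤ a) {r : ℝ} (hr : 1 ≤ r) {x : E}
    (hx : ‖x‖ = 1) : RCLike.re ⟪x, a x⟫ ^ r ≤ RCLike.re ⟪x, (a ^ r) x⟫ := by
  obtain hm | hm := (re_inner_nonneg_of_nonneg ha x).eq_or_lt
  · rw [← hm, Real.zero_rpow (by linarith)]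
    exact re_inner_nonneg_of_nonneg CFC.rpow_nonneg x
  set m := RCLike.re ⟪x, a x⟫
  set k := r * (m ^ r / m)
  have hle : algebraMap ℝ (E →L[ℂ] E) (m ^ r - k * m) + k • a ≤ a ^ r := by
    rw [← cfc_affine ha, CFC.rpow_eq_cfc_real ha]
    refine cfc_mono (fun t ht => ?_) (by fun_prop)
      (Real.continuous_rpow_const (by linarith)).continuousOn
    have := Real.add_mul_sub_le_rpow hm (spectrum_nonneg_of_nonneg ha ht) hr
    linarith
  have h := re_inner_mono hle x
  rw [re_inner_algebraMap_add_smul a _ _ hx] at h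
  linarith

theorem re_inner_rpow_le {a : E →L[ℂ] E} (ha : 0 ≤ a) {r : ℝ} (hr : 0 ≤ r) (hr' : r ≤ 1) {x : E}
    (hx : ‖x‖ = 1) : RCLike.re ⟪x, (a ^ r) x⟫ ≤ RCLike.re ⟪x, a x⟫ ^ r := by
  have hlim : Tendsto (fun m : ℝ => m ^ r) (𝓝[>] (RCLike.re ⟪x, a x⟫))
      (𝓝 (RCLike.re ⟪x, a x⟫ ^ r)) :=
    (Real.continuous_rpow_const hr).continuousAt.tendsto.mono_left nhdsWithin_le_nhds
  refine ge_of_tendsto hlim ?_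
  filter_upwards [self_mem_nhdsWithin] with m hm
  have hm0 : 0 < m := (re_inner_nonneg_of_nonneg ha x).trans_lt hm
  set k := r * (m ^ r / m)
  have hk : 0 ≤ k := by positivity
  have hle : a ^ r ≤ algebraMap ℝ (E →L[ℂ] E) (m ^ r - k * m) + k • a := by
    rw [← cfc_affine ha, CFC.rpow_eq_cfc_real ha]
    refine cfc_mono (fun t ht => ?_) (Real.continuous_rpow_const hr).continuousOn (by fun_prop)
    have := Real.rpow_le_add_mul_sub hm0 (spectrum_nonneg_of_nonneg ha ht) hr hr'
    linarith
  have h := re_inner_mono hle x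
  rw [re_inner_algebraMap_add_smul a _ _ hx] at h
  have hm' : RCLike.re ⟪x, a x⟫ ≤ m := le_of_lt hm
  nlinarith

open scoped ComplexOrder in
theorem re_inner_rpow_le_of_eigenvector {a : E →L[ℂ] E} (ha : 0 ≤ a) {r : ℝ} (hr : 0 < r) {x : E}
    (hx : ‖x‖ = 1) {μ : ℂ} (hμ : a x = μ • x) :
    RCLike.re ⟪x, (a ^ r) x⟫ ≤ RCLike.re ⟪x, a x⟫ ^ r := by
  have hinner : ⟪x, a x⟫ = μ := by
    rw [hμ, inner_smul_right, inner_self_eq_norm_sq_to_K, hx]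
    simp
  have hnonneg : 0 ≤ μ := hinner ▸ ((nonneg_iff_isPositive a).1 ha).inner_nonneg_right x
  obtain ⟨l, hl, rfl⟩ : ∃ l : ℝ, 0 ≤ l ∧ μ = l :=
    ⟨μ.re, (Complex.nonneg_iff.1 hnonneg).1, Complex.ext rfl (Complex.nonneg_iff.1 hnonneg).2.symm⟩
  have hpow (n : ℕ) : (a ^ n) x = ((l : ℂ) ^ n) • x := by
    induction n with
    | zero => simp
    | succ n ih => rw [pow_succ, mul_apply_eq_comp, hμ, map_smul, ih, smul_smul, pow_succ']
  set n := ⌈r⌉₊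
  have hn : 0 < n := Nat.ceil_pos.2 hr
  have hn' : (0 : ℝ) < n := Nat.cast_pos.2 hn
  have h := re_inner_rpow_le (a := a ^ n) (CFC.rpow_natCast a n ha ▸ CFC.rpow_nonneg) (r := r / n) (by positivity)
    ((div_le_one hn').2 (Nat.le_ceil r)) hx
  rw [← CFC.rpow_natCast a n ha, CFC.rpow_rpow_of_exponent_nonneg a _ _ hn'.le (by positivity) ha,
    mul_div_cancel₀ _ hn'.ne', CFC.rpow_natCast a n ha, hpow, inner_smul_right,
    inner_self_eq_norm_sq_to_K, hx] at h
  rw [hinner]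
  refine h.trans (le_of_eq ?_)
  have h2 : RCLike.re ((l : ℂ) ^ n * ((1 : ℝ) : ℂ) ^ 2) = l ^ n := by
    rw [Complex.ofReal_one, one_pow, mul_one, ← Complex.ofReal_pow]
    exact Complex.ofReal_re _
  have h3 : RCLike.re (l : ℂ) = l := by simp
  rw [h3]
  erw [h2]
  rw [← Real.rpow_natCast, ← Real.rpow_mul hl, mul_div_cancel₀ _ hn'.ne']

theorem OrthogonalFamily.exists_hilbertBasis_mem {F : Type u} {κ : Type v}
    [NormedAddCommGroup F] [InnerProductSpace ℂ F] [CompleteSpace F] {V : κ → Submodule ℂ F}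
    (hV : OrthogonalFamily ℂ (fun k => V k) fun k => (V k).subtypeₗᵢ)
    (hclosed : ∀ k, IsClosed (V k : Set F)) (hbot : (⨆ k, V k)ᗮ = ⊥) :
    ∃ (ι : Type max u v) (e : HilbertBasis ι ℂ F), ∀ i, ∃ k, e i ∈ V k := by
  have hcomplete (k : κ) : CompleteSpace (V k) := (hclosed k).completeSpace_coe
  choose w b _ using fun k => _root_.exists_hilbertBasis ℂ (V k)
  have hortho := hV.orthonormal_sigma_orthonormal
    (v_family := fun k => b k) fun k => (b k).orthonormal
  have hspan : (Submodule.span ℂ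
      (Set.range fun i : Σ k, w k => (V i.1).subtypeₗᵢ (b i.1 i.2)))ᗮ = ⊥ := by
    rw [eq_bot_iff, ← hbot]
    intro x hx
    rw [Submodule.mem_orthogonal'] at hx ⊢
    have hle : (⨆ k, V k) ≤ LinearMap.ker (innerSL ℂ x : F →ₗ[ℂ] ℂ) := by
      refine iSup_le fun k y hy => ?_
      have h0 : (innerSL ℂ x).comp (V k).subtypeL = 0 := by
        refine ContinuousLinearMap.ext_on (s := Set.range (b k)) ?_ ?_
        · rw [Submodule.dense_iff_topologicalClosure_eq_top]
          exact (b k).dense_span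
        · rintro _ ⟨j, rfl⟩
          exact hx (V k |>.subtypeₗᵢ (b k j)) (Submodule.subset_span ⟨⟨k, j⟩, rfl⟩)
      exact DFunLike.congr_fun h0 ⟨y, hy⟩
    exact fun y hy => hle hy
  exact ⟨_, HilbertBasis.mkOfOrthogonalEqBot hortho hspan, fun i => ⟨i.1, by
    rw [HilbertBasis.coe_mkOfOrthogonalEqBot]
    exact (b i.1 i.2).2⟩⟩

theorem IsCompactOperator.exists_hilbertBasis_eigenvectors {F : Type u} [NormedAddCommGroup F]
    [InnerProductSpace ℂ F] [CompleteSpace F] {a : F →L[ℂ] F}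
    (hc : IsCompactOperator a) (ha : IsSelfAdjoint a) :
    ∃ (ι : Type u) (e : HilbertBasis ι ℂ F), ∀ i, ∃ μ : ℂ, a (e i) = μ • e i := by
  have hsymm : (a : F →ₗ[ℂ] F).IsSymmetric := isSelfAdjoint_iff_isSymmetric.1 ha
  have hclosed (μ : ℂ) :
      IsClosed (Module.End.eigenspace (a : Module.End ℂ F) μ : Set F) := by
    have : (Module.End.eigenspace (a : Module.End ℂ F) μ : Set F) = {x | a x = μ • x} := by
      ext x
      exact Module.End.mem_eigenspace_iff
    rw [this]
    exact isClosed_eq a.continuous (continuous_const_smul μ)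
  obtain ⟨ι, e, he⟩ := hsymm.orthogonalFamily_eigenspaces.exists_hilbertBasis_mem hclosed
    (orthogonalComplement_iSup_eigenspaces_eq_bot hc hsymm)
  exact ⟨ι, e, fun i => (he i).imp fun μ h => Module.End.mem_eigenspace_iff.1 h⟩

theorem hilbertTrace_rpow_ne_top_of_le {a : E →L[ℂ] E} (ha : 0 ≤ a) {e : HilbertBasis ι ℂ E}
    {r s : ℝ} (hr : 0 < r) (hrs : r ≤ s) (h : hilbertTrace e (a ^ r) ≠ ⊤) :
    hilbertTrace e (a ^ s) ≠ ⊤ := by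
  have hle : a ^ s ≤ ‖a‖ ^ (s - r) • a ^ r := by
    rw [CFC.rpow_eq_cfc_real ha, CFC.rpow_eq_cfc_real ha,
      ← cfc_smul _ _ a (Real.continuous_rpow_const hr.le).continuousOn]
    refine cfc_mono (fun t ht => ?_) (Real.continuous_rpow_const (hr.le.trans hrs)).continuousOn
      ((Real.continuous_rpow_const hr.le).const_smul (‖a‖ ^ (s - r))).continuousOn
    have ht0 := spectrum_nonneg_of_nonneg ha ht
    have hta : t ≤ ‖a‖ := (le_abs_self t).trans (by simpa [cfc_id ℝ a] using norm_apply_le_norm_cfc (𝕜 := ℝ) id a ht)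
    obtain rfl | ht' := ht0.eq_or_lt
    · simp [Real.zero_rpow hr.ne', Real.zero_rpow (hr.trans_le hrs).ne']
    · calc t ^ s = t ^ (s - r) * t ^ r := by rw [← Real.rpow_add ht', sub_add_cancel]
        _ ≤ ‖a‖ ^ (s - r) * t ^ r := by gcongr
  refine ne_top_of_le_ne_top ?_ (hilbertTrace_mono e hle)
  rw [hilbertTrace_smul e (by positivity)]
  exact ENNReal.mul_ne_top ENNReal.ofReal_ne_top h

theorem isBasisLimit_of_hilbertTrace_pow_ne_top {e : HilbertBasis ℕ ℂ E} (k : ℕ) (S : E →L[ℂ] E)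
    (h : hilbertTrace e ((star S * S) ^ (2 ^ k)) ≠ ⊤) : IsBasisLimit e S := by
  induction k generalizing S with
  | zero =>
    rw [pow_zero, pow_one, hilbertTrace_star_mul_self] at h
    exact isBasisLimit_of_tsum_ne_top h
  | succ k ih =>
    refine IsBasisLimit.of_star_mul_self (ih _ ?_)
    rwa [star_mul, star_star, ← pow_two, ← pow_mul, ← pow_succ']

theorem isBasisLimit_of_hilbertTrace_rpow_ne_top {e : HilbertBasis ℕ ℂ E} {S : E →L[ℂ] E} {r : ℝ}
    (hr : 0 < r) (h : hilbertTrace e ((star S * S) ^ r) ≠ ⊤) : IsBasisLimit e S := by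
  have hpos : 0 ≤ star S * S := star_mul_self_nonneg S
  obtain ⟨k, hk⟩ := pow_unbounded_of_one_lt r one_lt_two
  refine isBasisLimit_of_hilbertTrace_pow_ne_top k S ?_
  rw [← CFC.rpow_natCast _ _ hpos]
  refine hilbertTrace_rpow_ne_top_of_le hpos hr ?_ h
  exact_mod_cast hk.le

theorem enorm_rpow_le_hilbertTrace (e : HilbertBasis ι ℂ E) (S : E →L[ℂ] E) {p : ℝ} (hp : 0 < p) :
    ‖S‖ₑ ^ p ≤ hilbertTrace e ((star S * S) ^ (p / 2)) := by
  refine le_trans (le_of_eq ?_) (enorm_le_hilbertTrace e CFC.rpow_nonneg)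
  rw [← ofReal_norm, ← ofReal_norm, CFC.norm_rpow _ (by positivity) (star_mul_self_nonneg S),
    CStarRing.norm_star_mul_self, ENNReal.ofReal_rpow_of_nonneg (norm_nonneg _) hp.le, ← sq,
    ← Real.rpow_natCast, ← Real.rpow_mul (norm_nonneg _)]
  congr 2
  push_cast
  ring


theorem CStarAlgebra.rpow_sub_one_le_rpow_sub_one {a b : E →L[ℂ] E} (ha : IsStrictlyPositive a)
    (hab : a ≤ b) {r : ℝ} (hr : 0 ≤ r) (hr' : r < 1) : b ^ (r - 1) ≤ a ^ (r - 1) := by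
  have hb : IsStrictlyPositive b := ha.of_le hab
  have h := CFC.rpow_le_rpow (p := 1 - r) ⟨by linarith, by linarith⟩ hab
  have h' := CStarAlgebra.rpow_neg_one_le_rpow_neg_one h (ha.rpow _ _)
  rwa [CFC.rpow_rpow _ _ _ (by linarith) hb, CFC.rpow_rpow _ _ _ (by linarith) ha,
    mul_neg_one, neg_sub] at h'

theorem sqrt_mul_rpow_mul_sqrt_le {a c : E →L[ℂ] E} (ha : 0 ≤ a) {δ r : ℝ} (hδ : 0 < δ)
    (hc : algebraMap ℝ (E →L[ℂ] E) δ + a ≤ c) (hr : 0 < r) (hr' : r < 1) :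
    a ^ (1 / 2 : ℝ) * c ^ (r - 1) * a ^ (1 / 2 : ℝ) ≤ a ^ r := by
  have hsa : IsSelfAdjoint a := ha.isSelfAdjoint
  have hspec {t : ℝ} (ht : t ∈ spectrum ℝ a) : 0 ≤ t := spectrum_nonneg_of_nonneg ha ht
  have hstrict : IsStrictlyPositive (algebraMap ℝ (E →L[ℂ] E) δ + a) :=
    (isStrictlyPositive_algebraMap hδ).add_nonneg ha
  have hcont : ContinuousOn (fun t : ℝ => (δ + 1 * t) ^ (r - 1)) (spectrum ℝ a) :=
    ContinuousOn.rpow_const (by fun_prop) fun t ht => Or.inl (by linarith [hspec ht])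
  have hcont' : ContinuousOn (fun t : ℝ => t ^ (1 / 2 : ℝ)) (spectrum ℝ a) :=
    (Real.continuous_rpow_const (by norm_num)).continuousOn
  have hmul' : ContinuousOn (fun t : ℝ => t ^ (1 / 2 : ℝ) * (δ + 1 * t) ^ (r - 1))
    (spectrum ℝ a) := hcont'.mul hcont
  refine (conjugate_le_conjugate_of_nonneg
    (CStarAlgebra.rpow_sub_one_le_rpow_sub_one hstrict hc hr.le hr') CFC.rpow_nonneg).trans ?_
  have haff : algebraMap ℝ (E →L[ℂ] E) δ + a = cfc (fun t : ℝ => δ + 1 * t) a := by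
    rw [cfc_affine ha, one_smul]
  rw [haff, CFC.cfc_rpow (fun t ht => by linarith [hspec ht]) (by fun_prop) hsa,
    CFC.rpow_eq_cfc_real ha, CFC.rpow_eq_cfc_real ha, ← cfc_mul _ _ a hcont' hcont,
    ← cfc_mul _ _ a hmul' hcont']
  refine cfc_mono (fun t ht => ?_) (hmul'.mul hcont')
    (Real.continuous_rpow_const hr.le).continuousOn
  obtain h0 | h0 := (hspec ht).eq_or_lt
  · simp [← h0, hr.ne']
  calc t ^ (1 / 2 : ℝ) * (δ + 1 * t) ^ (r - 1) * t ^ (1 / 2 : ℝ)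
      ≤ t ^ (1 / 2 : ℝ) * t ^ (r - 1) * t ^ (1 / 2 : ℝ) := by
        gcongr ?_ * ?_ * ?_
        exact Real.rpow_le_rpow_of_nonpos h0 (by linarith) (by linarith)
    _ = t ^ r := by
        rw [← Real.rpow_add h0, ← Real.rpow_add h0]
        congr 1
        ring

theorem hilbertTrace_conjugate_rpow_le (e : HilbertBasis ι ℂ E) {a c : E →L[ℂ] E} (ha : 0 ≤ a)
    {δ r : ℝ} (hδ : 0 < δ) (hc : algebraMap ℝ (E →L[ℂ] E) δ + a ≤ c) (hr : 0 < r) (hr' : r < 1) :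
    hilbertTrace e (c ^ ((r - 1) / 2) * a * c ^ ((r - 1) / 2)) ≤ hilbertTrace e (a ^ r) := by
  have hcpos : IsStrictlyPositive c :=
    ((isStrictlyPositive_algebraMap hδ).add_nonneg ha).of_le hc
  set d := c ^ ((r - 1) / 2)
  set q := a ^ (1 / 2 : ℝ)
  have hd : star d = d := (IsSelfAdjoint.of_nonneg CFC.rpow_nonneg).star_eq
  have hq : star q = q := (IsSelfAdjoint.of_nonneg CFC.rpow_nonneg).star_eq
  have hqq : q * q = a := by
    rw [show q = CFC.sqrt a from CFC.sqrt_eq_rpow.symm, CFC.sqrt_mul_sqrt_self a ha]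
  have hdd : d * d = c ^ (r - 1) := by
    rw [← CFC.rpow_add hcpos.isUnit, add_halves]
  have h := hilbertTrace_star_mul_self_comm e e (q * d)
  rw [star_mul, hd, hq] at h
  refine le_trans (le_of_eq ?_) (hilbertTrace_mono e (sqrt_mul_rpow_mul_sqrt_le ha hδ hc hr hr'))
  calc hilbertTrace e (d * a * d) = hilbertTrace e (d * q * (q * d)) := by
        rw [mul_assoc d q, ← mul_assoc q q, hqq, mul_assoc]
    _ = hilbertTrace e (q * c ^ (r - 1) * q) := by
        rw [h, ← hdd]
        simp only [mul_assoc]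

theorem rpow_le_conjugate_add {a : E →L[ℂ] E} (ha : 0 ≤ a) {δ r : ℝ} (hδ : 0 < δ) (hr : 0 < r)
    (hr' : r < 1) :
    a ^ r ≤ (algebraMap ℝ (E →L[ℂ] E) δ + a) ^ ((r - 1) / 2) * a *
      (algebraMap ℝ (E →L[ℂ] E) δ + a) ^ ((r - 1) / 2) + δ ^ r • 1 := by
  have hsa : IsSelfAdjoint a := ha.isSelfAdjoint
  have hspec {t : ℝ} (ht : t ∈ spectrum ℝ a) : 0 ≤ t := spectrum_nonneg_of_nonneg ha ht
  have hcont : ContinuousOn (fun t : ℝ => (δ + 1 * t) ^ ((r - 1) / 2)) (spectrum ℝ a) :=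
    ContinuousOn.rpow_const (by fun_prop) fun t ht => Or.inl (by linarith [hspec ht])
  have haff : algebraMap ℝ (E →L[ℂ] E) δ + a = cfc (fun t : ℝ => δ + 1 * t) a := by
    rw [cfc_affine ha, one_smul]
  have hid : ContinuousOn (fun t : ℝ => t) (spectrum ℝ a) := continuousOn_id
  have hmul : cfc (fun t : ℝ => (δ + 1 * t) ^ ((r - 1) / 2)) a * a *
      cfc (fun t : ℝ => (δ + 1 * t) ^ ((r - 1) / 2)) a =
      cfc (fun t : ℝ => (δ + 1 * t) ^ ((r - 1) / 2) * t * (δ + 1 * t) ^ ((r - 1) / 2)) a := by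
    rw [cfc_mul (fun t : ℝ => (δ + 1 * t) ^ ((r - 1) / 2) * t) _ a (hcont.mul hid) hcont,
       cfc_mul _ _ a hcont hid,
      cfc_id' ℝ a]
  have hcont' : ContinuousOn (fun t : ℝ => (δ + 1 * t) ^ ((r - 1) / 2) * t *
    (δ + 1 * t) ^ ((r - 1) / 2)) (spectrum ℝ a) := (hcont.mul hid).mul hcont
  rw [haff, CFC.cfc_rpow (fun t ht => by linarith [hspec ht]) (by fun_prop) hsa, hmul,
    ← Algebra.algebraMap_eq_smul_one, ← cfc_add_const _ _ a hcont', CFC.rpow_eq_cfc_real ha]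
  refine cfc_mono (fun t ht => ?_) (Real.continuous_rpow_const hr.le).continuousOn
    (hcont'.add continuousOn_const)
  have h0 := hspec ht
  have hpos : 0 < δ + t := by linarith
  calc t ^ r ≤ (δ + t) ^ r := by gcongr; linarith
    _ = (δ + t) ^ (r - 1) * t + (δ + t) ^ (r - 1) * δ := by
        rw [← mul_add, add_comm t δ, Real.rpow_sub_one hpos.ne', div_mul_cancel₀ _ hpos.ne']
    _ ≤ (δ + t) ^ (r - 1) * t + δ ^ (r - 1) * δ := by
        refine add_le_add le_rfl (mul_le_mul_of_nonneg_right ?_ hδ.le)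
        exact Real.rpow_le_rpow_of_nonpos hδ (by linarith) (by linarith)
    _ = (δ + 1 * t) ^ ((r - 1) / 2) * t * (δ + 1 * t) ^ ((r - 1) / 2) + δ ^ r := by
        rw [Real.rpow_sub_one hδ.ne', div_mul_cancel₀ _ hδ.ne', one_mul, mul_right_comm,
          ← Real.rpow_add hpos, add_halves]

/-- Rotfel'd's inequality. -/
theorem hilbertTrace_add_rpow_le (e : HilbertBasis ι ℂ E) {a b : E →L[ℂ] E} (ha : 0 ≤ a)
    (hb : 0 ≤ b) {r : ℝ} (hr : 0 < r) (hr' : r < 1) :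
    hilbertTrace e ((a + b) ^ r) ≤ hilbertTrace e (a ^ r) + hilbertTrace e (b ^ r) := by
  rw [hilbertTrace, ENNReal.tsum_eq_iSup_sum]
  refine iSup_le fun s => ?_
  have hlim : Tendsto (fun δ : ℝ => hilbertTrace e (a ^ r) + hilbertTrace e (b ^ r) +
      s.card * ENNReal.ofReal (δ ^ r)) (𝓝[>] 0)
      (𝓝 (hilbertTrace e (a ^ r) + hilbertTrace e (b ^ r))) := by
    have h1 : Tendsto (fun δ : ℝ => δ ^ r) (𝓝[>] 0) (𝓝 (0 ^ r)) :=
      (Real.continuous_rpow_const hr.le).continuousAt.tendsto.mono_left nhdsWithin_le_nhds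
    rw [Real.zero_rpow hr.ne'] at h1
    have h2 := ENNReal.Tendsto.const_mul (a := (s.card : ℝ≥0∞)) (ENNReal.tendsto_ofReal h1)
      (Or.inr (ENNReal.natCast_ne_top _))
    have h3 := tendsto_const_nhds (x := hilbertTrace e (a ^ r) + hilbertTrace e (b ^ r)).add h2
    simpa using h3
  refine ge_of_tendsto hlim ?_
  filter_upwards [self_mem_nhdsWithin] with δ hδ
  replace hδ : 0 < δ := hδ
  set c := algebraMap ℝ (E →L[ℂ] E) δ + (a + b)
  set d := c ^ ((r - 1) / 2)
  have hac : algebraMap ℝ (E →L[ℂ] E) δ + a ≤ c :=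
    add_le_add le_rfl (le_add_of_nonneg_right hb)
  have hbc : algebraMap ℝ (E →L[ℂ] E) δ + b ≤ c :=
    add_le_add le_rfl (le_add_of_nonneg_left ha)
  have hle := rpow_le_conjugate_add (add_nonneg ha hb) hδ hr hr'
  have hterm (i : ι) : ENNReal.ofReal (RCLike.re ⟪e i, ((a + b) ^ r) (e i)⟫) ≤
      ENNReal.ofReal (RCLike.re ⟪e i, (d * (a + b) * d) (e i)⟫) + ENNReal.ofReal (δ ^ r) := by
    have h := re_inner_mono hle (e i)
    rw [add_apply, inner_add_right, map_add, smul_apply, one_apply_eq_self,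
      inner_smul_right_eq_smul, RCLike.smul_re, inner_self_eq_norm_sq,
      e.orthonormal.norm_eq_one, one_pow, mul_one] at h
    exact (ENNReal.ofReal_le_ofReal h).trans ENNReal.ofReal_add_le
  calc ∑ i ∈ s, ENNReal.ofReal (RCLike.re ⟪e i, ((a + b) ^ r) (e i)⟫)
      ≤ ∑ i ∈ s, (ENNReal.ofReal (RCLike.re ⟪e i, (d * (a + b) * d) (e i)⟫) +
          ENNReal.ofReal (δ ^ r)) := Finset.sum_le_sum fun i _ => hterm i
    _ ≤ hilbertTrace e (d * (a + b) * d) + s.card * ENNReal.ofReal (δ ^ r) := by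
        rw [Finset.sum_add_distrib, Finset.sum_const, nsmul_eq_mul]
        gcongr
        exact ENNReal.sum_le_tsum s
    _ ≤ hilbertTrace e (a ^ r) + hilbertTrace e (b ^ r) +
          s.card * ENNReal.ofReal (δ ^ r) := by
        gcongr
        rw [mul_add, add_mul]
        exact (hilbertTrace_add_le e _ _).trans
          (add_le_add (hilbertTrace_conjugate_rpow_le e ha hδ hac hr hr')
            (hilbertTrace_conjugate_rpow_le e hb hδ hbc hr hr'))

theorem star_sub_mul_sub_le (A B : E →L[ℂ] E) :
    star (A - B) * (A - B) ≤ (2 : ℝ) • (star A * A) + (2 : ℝ) • (star B * B) := by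
  rw [← sub_nonneg]
  refine (star_mul_self_nonneg (A + B)).trans_eq ?_
  rw [star_add, star_sub, two_smul, two_smul]
  noncomm_ring

theorem hilbertTrace_smul_rpow_ne_top {e : HilbertBasis ι ℂ E} {a : E →L[ℂ] E} (ha : 0 ≤ a)
    {k r : ℝ} (hk : 0 ≤ k) (hr : 0 < r) (h : hilbertTrace e (a ^ r) ≠ ⊤) :
    hilbertTrace e ((k • a) ^ r) ≠ ⊤ := by
  have hsa : IsSelfAdjoint a := ha.isSelfAdjoint
  have hcont : Continuous fun t : ℝ => t ^ r := Real.continuous_rpow_const hr.le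
  have hpow : (k • a) ^ r = k ^ r • a ^ r := by
    rw [CFC.rpow_eq_cfc_real (smul_nonneg hk ha), CFC.rpow_eq_cfc_real ha,
      ← cfc_comp_smul k (fun t : ℝ => t ^ r) a hcont.continuousOn,
      ← cfc_smul (k ^ r) (fun t : ℝ => t ^ r) a hcont.continuousOn]
    exact cfc_congr fun t ht => Real.mul_rpow hk (spectrum_nonneg_of_nonneg ha ht)
  rw [hpow, hilbertTrace_smul e (by positivity)]
  exact ENNReal.mul_ne_top ENNReal.ofReal_ne_top h

theorem enorm_apply_rpow_eq (S : E →L[ℂ] E) (x : E) {p : ℝ} (hp : 0 ≤ p) :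
    ‖S x‖ₑ ^ p = ENNReal.ofReal (RCLike.re ⟪x, (star S * S) x⟫ ^ (p / 2)) := by
  rw [star_eq_adjoint, mul_apply_eq_comp, adjoint_inner_right, inner_self_eq_norm_sq, ← ofReal_norm,
    ENNReal.ofReal_rpow_of_nonneg (norm_nonneg _) hp, ← Real.rpow_natCast,
    ← Real.rpow_mul (norm_nonneg _)]
  congr 2
  push_cast
  ring

theorem tsum_enorm_rpow_le_hilbertTrace (e : HilbertBasis ι ℂ E) (S : E →L[ℂ] E) {p : ℝ}
    (hp : 2 ≤ p) : ∑' i, ‖S (e i)‖ₑ ^ p ≤ hilbertTrace e ((star S * S) ^ (p / 2)) := by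
  refine ENNReal.tsum_le_tsum fun i => ?_
  rw [enorm_apply_rpow_eq S _ (by linarith)]
  exact ENNReal.ofReal_le_ofReal
    (rpow_re_inner_le (star_mul_self_nonneg S) (by linarith) (e.orthonormal.norm_eq_one i))

theorem hilbertTrace_rpow_le_tsum_of_eigenvectors {e : HilbertBasis ι ℂ E} {S : E →L[ℂ] E}
    (he : ∀ i, ∃ μ : ℂ, (star S * S) (e i) = μ • e i) {p : ℝ} (hp : 0 < p) :
    hilbertTrace e ((star S * S) ^ (p / 2)) ≤ ∑' i, ‖S (e i)‖ₑ ^ p := by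
  refine ENNReal.tsum_le_tsum fun i => ?_
  obtain ⟨μ, hμ⟩ := he i
  rw [enorm_apply_rpow_eq S _ hp.le]
  exact ENNReal.ofReal_le_ofReal (re_inner_rpow_le_of_eigenvector (star_mul_self_nonneg S)
    (by positivity) (e.orthonormal.norm_eq_one i) hμ)

theorem hilbertTrace_star_mul_self_sub_rpow_ne_top {e : HilbertBasis ℕ ℂ E} {A B : E →L[ℂ] E}
    {p : ℝ} (hp : 0 < p) (hA : hilbertTrace e ((star A * A) ^ (p / 2)) ≠ ⊤)
    (hB : hilbertTrace e ((star B * B) ^ (p / 2)) ≠ ⊤) :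
    hilbertTrace e ((star (A - B) * (A - B)) ^ (p / 2)) ≠ ⊤ := by
  have hA0 : 0 ≤ star A * A := star_mul_self_nonneg A
  have hB0 : 0 ≤ star B * B := star_mul_self_nonneg B
  obtain hp2 | hp2 := lt_or_ge p 2
  · refine ne_top_of_le_ne_top (ENNReal.add_ne_top.2
      ⟨hilbertTrace_smul_rpow_ne_top hA0 zero_le_two (half_pos hp) hA,
        hilbertTrace_smul_rpow_ne_top hB0 zero_le_two (half_pos hp) hB⟩) ?_
    refine le_trans (hilbertTrace_mono e (CFC.rpow_le_rpow ⟨by positivity, by linarith⟩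
      (star_sub_mul_sub_le A B))) ?_
    exact hilbertTrace_add_rpow_le e (smul_nonneg zero_le_two hA0) (smul_nonneg zero_le_two hB0)
      (by positivity) (by linarith)
  · have hlim : IsBasisLimit e (A - B) :=
      (isBasisLimit_of_hilbertTrace_rpow_ne_top (half_pos hp) hA).sub
        (isBasisLimit_of_hilbertTrace_rpow_ne_top (half_pos hp) hB)
    obtain ⟨ι, g, hg⟩ := (hlim.mul_left (star (A - B))).isCompactOperator
      |>.exists_hilbertBasis_eigenvectors (IsSelfAdjoint.star_mul_self (A - B))
    rw [hilbertTrace_basis_indep e g CFC.rpow_nonneg] at hA hB ⊢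
    refine ne_top_of_le_ne_top ?_ (hilbertTrace_rpow_le_tsum_of_eigenvectors hg hp)
    have hle (i : ι) : ‖(A - B) (g i)‖ₑ ^ p ≤
        2 ^ (p - 1) * (‖A (g i)‖ₑ ^ p + ‖B (g i)‖ₑ ^ p) :=
      (ENNReal.rpow_le_rpow enorm_sub_le hp.le).trans
        (ENNReal.rpow_add_le_mul_rpow_add_rpow _ _ (by linarith))
    refine ne_top_of_le_ne_top ?_ (ENNReal.tsum_le_tsum hle)
    rw [ENNReal.tsum_mul_left, ENNReal.tsum_add]
    refine ENNReal.mul_ne_top (ENNReal.rpow_ne_top_of_nonneg (by linarith) (by norm_num))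
      (ENNReal.add_ne_top.2 ⟨?_, ?_⟩)
    · exact ne_top_of_le_ne_top hA (tsum_enorm_rpow_le_hilbertTrace g A hp2)
    · exact ne_top_of_le_ne_top hB (tsum_enorm_rpow_le_hilbertTrace g B hp2)

end OperatorPowers

section Schatten

variable {E : Type*} [NormedAddCommGroup E] [InnerProductSpace ℂ E] [CompleteSpace E]

theorem absPow_eq_rpow (S : E →L[ℂ] E) (p : ℝ) : absPow S p = (star S * S) ^ (p / 2) :=
  (CFC.rpow_eq_cfc_real (star_mul_self_nonneg S)).symm

theorem trAbsPow_eq_hilbertTrace (f : HilbertBasis ℕ ℂ E) (S : E →L[ℂ] E) (p : ℝ) :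
    trAbsPow f S p = hilbertTrace f ((star S * S) ^ (p / 2)) := by
  rw [trAbsPow, absPow_eq_rpow]
  rfl

theorem norm_le_sNorm {f : HilbertBasis ℕ ℂ E} {S : E →L[ℂ] E} {p : ℝ} (hp : 0 < p)
    (h : trAbsPow f S p ≠ ⊤) : ‖S‖ ≤ sNorm f p S := by
  have hle : ‖S‖ ^ p ≤ (trAbsPow f S p).toReal := by
    have h1 := ENNReal.toReal_mono h
      ((trAbsPow_eq_hilbertTrace f S p).symm ▸ enorm_rpow_le_hilbertTrace f S hp)
    rwa [← ENNReal.toReal_rpow, toReal_enorm] at h1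
  rw [sNorm, one_div]
  exact (Real.le_rpow_inv_iff_of_pos (norm_nonneg _) ENNReal.toReal_nonneg hp).2 hle

end Schatten

section UniformApproximation

variable {E X : Type*} [NormedAddCommGroup E] [InnerProductSpace ℂ E] [CompleteSpace E]
  [TopologicalSpace X]

theorem norm_mul_one_sub_basisProj_antitone (e : HilbertBasis ℕ ℂ E) (S : E →L[ℂ] E) :
    Antitone fun n => ‖S * (1 - basisProj e n)‖ := by
  intro m n hmn
  have hmul : (1 - basisProj e m) * (1 - basisProj e n) = 1 - basisProj e n := by
    have h := congrArg star (basisProj_mul_of_le e hmn)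
    rw [star_mul, (isStarProjection_basisProj e m).isSelfAdjoint.star_eq,
      (isStarProjection_basisProj e n).isSelfAdjoint.star_eq] at h
    rw [sub_mul, one_mul, mul_sub, mul_one, h, sub_self, sub_zero]
  change ‖S * (1 - basisProj e n)‖ ≤ ‖S * (1 - basisProj e m)‖
  rw [← hmul, ← mul_assoc]
  exact (norm_mul_le _ _).trans
    (mul_le_of_le_one_right (norm_nonneg _) (norm_one_sub_basisProj_le e n))

theorem norm_basisProj_le (e : HilbertBasis ℕ ℂ E) (n : ℕ) : ‖basisProj e n‖ ≤ 1 :=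
  (isStarProjection_basisProj e n).norm_le

theorem exists_forall_norm_mul_one_sub_basisProj_lt {e : HilbertBasis ℕ ℂ E} {T : X → E →L[ℂ] E}
    (hcont : Continuous T) (hzero : Tendsto T (cocompact X) (𝓝 0))
    (hT : ∀ x, IsBasisLimit e (T x)) {δ : ℝ} (hδ : 0 < δ) :
    ∃ n, ∀ x, ‖T x * (1 - basisProj e n)‖ < δ := by
  have hmul (n : ℕ) (S : E →L[ℂ] E) : ‖S * (1 - basisProj e n)‖ ≤ ‖S‖ :=
    (norm_mul_le _ _).trans
      (mul_le_of_le_one_right (norm_nonneg _) (norm_one_sub_basisProj_le e n))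
  obtain ⟨K, hK, hKT⟩ := mem_cocompact.1 (hzero (Metric.ball_mem_nhds 0 hδ))
  have hopen (n : ℕ) : IsOpen {x | ‖T x * (1 - basisProj e n)‖ < δ} :=
    isOpen_lt (by fun_prop) continuous_const
  obtain ⟨n, hn⟩ := hK.elim_directed_cover _ hopen
    (fun x _ => Set.mem_iUnion.2 ((hT x).eventually_lt_const hδ).exists)
    (Monotone.directed_le fun m n hmn x hx =>
      (norm_mul_one_sub_basisProj_antitone e (T x) hmn).trans_lt hx)
  refine ⟨n, fun x => ?_⟩
  by_cases hx : x ∈ K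
  · exact hn hx
  · exact (hmul n _).trans_lt (mem_ball_zero_iff.1 (hKT hx))

theorem exists_rankOne_sum_approx {e : HilbertBasis ℕ ℂ E} {T : X → E →L[ℂ] E}
    (hcont : Continuous T) (hzero : Tendsto T (cocompact X) (𝓝 0))
    (hT : ∀ x, IsBasisLimit e (T x)) {δ : ℝ} (hδ : 0 < δ) :
    ∃ (n : ℕ) (v w : Fin n → X → E),
      (∀ i, Continuous (v i) ∧ Tendsto (v i) (cocompact X) (𝓝 0)) ∧
      (∀ i, Continuous (w i) ∧ Tendsto (w i) (cocompact X) (𝓝 0)) ∧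
      ∀ x, ‖T x - ∑ i, (innerSL ℂ (w i x)).smulRight (v i x)‖ ≤ 2 * δ := by
  obtain ⟨n, hn⟩ := exists_forall_norm_mul_one_sub_basisProj_lt hcont hzero hT hδ
  set φ : X → ℝ := fun x => min 1 (‖T x‖ / δ)
  have hφ : Continuous φ := continuous_const.min (hcont.norm.div_const δ)
  have hφ0 : Tendsto φ (cocompact X) (𝓝 0) := by
    have h := (tendsto_const_nhds (x := (1 : ℝ))).min (hzero.norm.div_const δ)
    simpa using h
  refine ⟨n, fun i x => T x (e i), fun i x => φ x • e i, fun i => ⟨by fun_prop, ?_⟩,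
    fun i => ⟨by fun_prop, ?_⟩, fun x => ?_⟩
  · simpa [Function.comp_def] using
      ((ContinuousLinearMap.apply ℂ E (e i)).continuous.tendsto 0).comp hzero
  · simpa using hφ0.smul_const (e i)
  have hsum : ∑ i : Fin n, (innerSL ℂ (φ x • e i)).smulRight (T x (e i)) =
      φ x • (T x * basisProj e n) := by
    ext y
    rw [sum_apply, smul_apply, mul_apply_eq_comp, basisProj_apply, map_sum, Finset.smul_sum,
      Finset.sum_range]
    refine Finset.sum_congr rfl fun i _ => ?_
    rw [smulRight_apply, innerSL_apply_apply, map_smul, inner_smul_left_eq_smul, smul_assoc]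
  have hφle : φ x ≤ 1 := min_le_left _ _
  have hdecomp : T x - φ x • (T x * basisProj e n) =
      T x * (1 - basisProj e n) + (1 - φ x) • (T x * basisProj e n) := by
    rw [mul_sub, mul_one, sub_smul, one_smul]
    abel
  have hrest : (1 - φ x) * ‖T x * basisProj e n‖ ≤ δ := by
    obtain h | h := le_total δ ‖T x‖
    · have : φ x = 1 := min_eq_left ((one_le_div hδ).2 h)
      rw [this, sub_self, zero_mul]
      exact hδ.le
    · have hφ' : 0 ≤ φ x := le_min zero_le_one (by positivity)
      have hTP : ‖T x * basisProj e n‖ ≤ δ := ((norm_mul_le _ _).trans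
        (mul_le_of_le_one_right (norm_nonneg _) (norm_basisProj_le e n))).trans h
      nlinarith [norm_nonneg (T x * basisProj e n)]
  calc ‖T x - ∑ i : Fin n, (innerSL ℂ (φ x • e i)).smulRight (T x (e i))‖
      = ‖T x * (1 - basisProj e n) + (1 - φ x) • (T x * basisProj e n)‖ := by rw [hsum, hdecomp]
    _ ≤ ‖T x * (1 - basisProj e n)‖ + (1 - φ x) * ‖T x * basisProj e n‖ := by
        refine (norm_add_le _ _).trans_eq ?_
        rw [norm_smul, Real.norm_of_nonneg (sub_nonneg.2 hφle)]
    _ ≤ δ + δ := add_le_add (hn x).le hrest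
    _ = 2 * δ := by ring

end UniformApproximation

/-- every `T ∈ C₀(X, S_p(H))` is a compact operator on the Hilbert
`C₀(X)`-module `C₀(X,H)`: it is an operator-norm limit of finite sums of pointwise
rank-one operators with coefficients in `C₀(X,H)`. -/
theorem c0Schatten_compact {X : Type*} [TopologicalSpace X]
    [LocallyCompactSpace X] [T2Space X]
    (f : HilbertBasis ℕ ℂ H) (p : ℝ) (hp : 1 ≤ p)
    (T : X → H →L[ℂ] H) (hT : IsC0Schatten f p T) :
    ∀ ε > (0 : ℝ), ∃ (n : ℕ) (v w : Fin n → X → H),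
      (∀ i, Continuous (v i) ∧ Tendsto (v i) (cocompact X) (nhds 0)) ∧
      (∀ i, Continuous (w i) ∧ Tendsto (w i) (cocompact X) (nhds 0)) ∧
      (⨆ x, ‖T x - ∑ i, (innerSL ℂ (w i x)).smulRight (v i x)‖) < ε := by
  obtain ⟨hfin, hcont, hzero⟩ := hT
  have hp0 : 0 < p := zero_lt_one.trans_le hp
  have hsub (x y : X) : trAbsPow f (T y - T x) p ≠ ⊤ := by
    simp_rw [trAbsPow_eq_hilbertTrace] at hfin ⊢
    exact hilbertTrace_star_mul_self_sub_rpow_ne_top hp0 (hfin y) (hfin x)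
  have hcontT : Continuous T := continuous_iff_continuousAt.2 fun x =>
    tendsto_iff_norm_sub_tendsto_zero.2 <|
      squeeze_zero (fun _ => norm_nonneg _) (fun y => norm_le_sNorm hp0 (hsub x y)) (hcont x)
  have hzeroT : Tendsto T (cocompact X) (𝓝 0) := tendsto_zero_iff_norm_tendsto_zero.2 <|
    squeeze_zero (fun _ => norm_nonneg _) (fun x => norm_le_sNorm hp0 (hfin x)) hzero
  have hlim (x : X) : IsBasisLimit f (T x) :=
    isBasisLimit_of_hilbertTrace_rpow_ne_top (half_pos hp0)
      (trAbsPow_eq_hilbertTrace f (T x) p ▸ hfin x)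
  intro ε hε
  obtain ⟨n, v, w, hv, hw, hle⟩ := exists_rankOne_sum_approx hcontT hzeroT hlim
    (δ := ε / 4) (by positivity)
  exact ⟨n, v, w, hv, hw, (Real.iSup_le hle (by positivity)).trans_lt (by linarith)⟩

end
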